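/- Let P ∈ ℂ[X_1,…,X_n] be a reduced (squarefree) X_1-generic polynomial with factorization P = P_1 ⋯ P_s into distinct irreducible factors, and for j = 1,…,s set B^j_1 = (∏_{k≠j} P_k)·(∂P_j/∂X_1). Let v ∈ ℂ[X_1,…,X_n] and λ_1,…,λ_s ∈ ℂ be pairwise distinct scalars such that v − Σ_{j=1}^s λ_j B^j_1 is divisible by P. Then for each i = 1,…,s, a greatest common divisor of P and v − λ_i·(∂P/∂X_1) in ℂ[X_1,…,X_n] is the irreducible factor P_i (up to multiplication by a unit), i.e., P_i = gcd(P, v − λ_i·∂P/∂X_1) up to associates. -/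

import Mathlib

open MvPolynomial

/-- A polynomial `P ∈ ℂ[X_1,…,X_{n+1}]` (variable `0` playing the role of `X_1`)
is `X_1`-generic if the projection forgetting the first coordinate, restricted to
the hypersurface `V(P)`, has finite fibers: for every `b ∈ ℂⁿ` the set
`{t ∈ ℂ : P(t, b) = 0}` is finite. -/
def IsX1Generic (n : ℕ) (P : MvPolynomial (Fin (n + 1)) ℂ) : Prop :=
  ∀ b : Fin n → ℂ, {t : ℂ | eval (Fin.cons t b) P = 0}.Finite


/-- Leibniz rule for a finite product. -/
theorem pderiv_prod {R σ ι : Type*} [CommRing R] [DecidableEq ι] (a : σ) (s : Finset ι)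
    (f : ι → MvPolynomial σ R) :
    pderiv a (∏ j ∈ s, f j) = ∑ j ∈ s, (∏ k ∈ s.erase j, f k) * pderiv a (f j) := by
  induction s using Finset.induction_on with
  | empty => simp
  | insert i s hi ih =>
    rw [Finset.prod_insert hi, pderiv_mul, ih, Finset.sum_insert hi, Finset.erase_insert hi,
      Finset.mul_sum, mul_comm (pderiv a (f i))]
    congr 1
    refine Finset.sum_congr rfl fun j hj => ?_
    have hij : i ≠ j := fun h => hi (h ▸ hj)
    rw [Finset.erase_insert_of_ne hij,
      Finset.prod_insert fun h => hi (Finset.mem_of_mem_erase h), mul_assoc]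

/-- Restriction of a polynomial to the line parallel to the first axis through `b`. -/
noncomputable def restrictLine {n : ℕ} (b : Fin n → ℂ) :
    MvPolynomial (Fin (n + 1)) ℂ →ₐ[ℂ] Polynomial ℂ :=
  aeval (Fin.cons Polynomial.X fun i => Polynomial.C (b i))

theorem derivative_restrictLine {n : ℕ} (b : Fin n → ℂ) (p : MvPolynomial (Fin (n + 1)) ℂ) :
    Polynomial.derivative (restrictLine b p) = restrictLine b (pderiv 0 p) := by
  induction p using MvPolynomial.induction_on with
  | C c => simp [restrictLine]
  | add p q hp hq => simp [hp, hq]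
  | mul_X p i hp =>
    have hX : Polynomial.derivative (restrictLine b (X i)) = restrictLine b (pderiv 0 (X i)) := by
      refine Fin.cases ?_ (fun j => ?_) i
      · simp [restrictLine]
      · simp [restrictLine, pderiv_X_of_ne (Fin.succ_ne_zero j)]
    rw [map_mul, Polynomial.derivative_mul, hp, hX, pderiv_mul, map_add, map_mul, map_mul]

theorem eval_restrictLine {n : ℕ} (b : Fin n → ℂ) (t : ℂ) (p : MvPolynomial (Fin (n + 1)) ℂ) :
    (restrictLine b p).eval t = eval (Fin.cons t b) p := by
  induction p using MvPolynomial.induction_on with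
  | C c => simp [restrictLine]
  | add p q hp hq => simp [hp, hq]
  | mul_X p i hp =>
    rw [map_mul, map_mul, Polynomial.eval_mul, hp]
    congr 1
    refine Fin.cases ?_ (fun j => ?_) i <;> simp [restrictLine]

/-- Weak Nullstellensatz for a single polynomial: a nonunit has a zero. -/
theorem exists_eval_eq_zero_of_not_isUnit {σ K : Type*} [Finite σ] [Field K] [IsAlgClosed K]
    {p : MvPolynomial σ K} (hp : ¬ IsUnit p) : ∃ x : σ → K, eval x p = 0 := by
  obtain ⟨M, hM, hpM⟩ := exists_max_ideal_of_mem_nonunits hp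
  obtain ⟨x, rfl⟩ := isMaximal_iff_eq_vanishingIdeal_singleton.mp hM
  exact ⟨x, by simpa [aeval_eq_eval] using (mem_vanishingIdeal_singleton_iff x p).mp hpM⟩

theorem IsX1Generic.of_dvd {n : ℕ} {p q : MvPolynomial (Fin (n + 1)) ℂ}
    (hq : IsX1Generic n q) (hpq : p ∣ q) : IsX1Generic n p := by
  obtain ⟨r, rfl⟩ := hpq
  exact fun b => (hq b).subset fun t ht => by simp_all

/-- A nonunit generic polynomial does not divide its derivative along the generic direction. -/
theorem IsX1Generic.not_dvd_pderiv {n : ℕ} {p : MvPolynomial (Fin (n + 1)) ℂ}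
    (hp : IsX1Generic n p) (hu : ¬ IsUnit p) : ¬ p ∣ pderiv 0 p := by
  intro hdvd
  obtain ⟨x, hx⟩ := exists_eval_eq_zero_of_not_isUnit hu
  have hroot : (restrictLine (Fin.tail x) p).eval (x 0) = 0 := by
    rw [eval_restrictLine, Fin.cons_self_tail, hx]
  have hconst := Polynomial.eq_C_of_derivative_eq_zero <| Polynomial.dvd_derivative_iff.mp <|
    derivative_restrictLine (Fin.tail x) p ▸ map_dvd (restrictLine (Fin.tail x)) hdvd
  have hzero : restrictLine (Fin.tail x) p = 0 := by
    rw [hconst, Polynomial.eval_C] at hroot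
    rw [hconst, hroot, Polynomial.C_0]
  refine Set.infinite_univ ((hp (Fin.tail x)).subset fun t _ => ?_)
  simp [← eval_restrictLine, hzero]

/-- let `P = P_1 ⋯ P_s ∈ ℂ[X_1,…,X_{n+1}]` be reduced (squarefree)
and `X_1`-generic, with distinct irreducible factors, and let
`B^j_1 = (∏_{k≠j} P_k)·∂P_j/∂X_1`.  If `λ_1,…,λ_s` are pairwise distinct and
`v − Σ_j λ_j·B^j_1` is divisible by `P`, then for every `i` the factor `P_i` is
a greatest common divisor of `P` and `v − λ_i·∂P/∂X_1` (up to associates): it is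
a common divisor, and every common divisor divides it. -/
theorem factor_is_gcd
    (n : ℕ) (P : MvPolynomial (Fin (n + 1)) ℂ) (s : ℕ)
    (Q : Fin s → MvPolynomial (Fin (n + 1)) ℂ)
    (hfac : P = ∏ i, Q i) (hirr : ∀ i, Irreducible (Q i))
    (hdist : ∀ i j, i ≠ j → ¬ Associated (Q i) (Q j))
    (hgen : IsX1Generic n P)
    (B : Fin s → MvPolynomial (Fin (n + 1)) ℂ)
    (hB : ∀ j, B j = (∏ k ∈ Finset.univ.erase j, Q k) * pderiv 0 (Q j))
    (v : MvPolynomial (Fin (n + 1)) ℂ) (lam : Fin s → ℂ)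
    (hlam : ∀ i j, i ≠ j → lam i ≠ lam j)
    (hv : P ∣ v - ∑ j, C (lam j) * B j) :
    ∀ i, Q i ∣ P ∧ Q i ∣ (v - C (lam i) * pderiv 0 P) ∧
      ∀ d : MvPolynomial (Fin (n + 1)) ℂ,
        d ∣ P → d ∣ (v - C (lam i) * pderiv 0 P) → d ∣ Q i := by
  classical
  intro i
  have hQP : ∀ k, Q k ∣ P := fun k => hfac ▸ Finset.dvd_prod_of_mem Q (Finset.mem_univ k)
  have hQB : ∀ k j, j ≠ k → Q k ∣ B j := fun k j hjk => hB j ▸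
    (Finset.dvd_prod_of_mem Q (Finset.mem_erase.mpr ⟨hjk.symm, Finset.mem_univ k⟩)).mul_right _
  have hderiv : pderiv 0 P = ∑ j, B j := by simp only [hfac, pderiv_prod, hB]
  -- Modulo `Q k`, only the `k`-th summand of `v - λ_i ∂P` survives.
  have hmod : ∀ k, Q k ∣ (v - C (lam i) * pderiv 0 P) - C (lam k - lam i) * B k := by
    intro k
    have hsplit : (v - C (lam i) * pderiv 0 P) - C (lam k - lam i) * B k =
        (v - ∑ j, C (lam j) * B j) +
          ∑ j ∈ Finset.univ.erase k, C (lam j - lam i) * B j := by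
      rw [hderiv, Finset.mul_sum, ← Finset.add_sum_erase _ (fun j => C (lam i) * B j)
        (Finset.mem_univ k), ← Finset.add_sum_erase _ (fun j => C (lam j) * B j)
        (Finset.mem_univ k)]
      simp only [C_sub, sub_mul, Finset.sum_sub_distrib]
      ring
    rw [hsplit]
    exact dvd_add ((hQP k).trans hv) <| Finset.dvd_sum fun j hj =>
      (hQB k j (Finset.ne_of_mem_erase hj)).mul_left _
  refine ⟨hQP i, by simpa using hmod i, fun d hdP hdv => ?_⟩
  have hndvd : ∀ k, k ≠ i → ¬ Q k ∣ d := by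
    intro k hki hkd
    have hprime := (hirr k).prime
    have hk : Q k ∣ C (lam k - lam i) * B k := (dvd_sub_right (hkd.trans hdv)).mp (hmod k)
    have hunit : IsUnit (C (lam k - lam i) : MvPolynomial (Fin (n + 1)) ℂ) :=
      (sub_ne_zero.mpr (hlam k i hki)).isUnit.map C
    rw [hunit.dvd_mul_left, hB] at hk
    rcases hprime.dvd_or_dvd hk with h | h
    · obtain ⟨l, hl, hkl⟩ := (hprime.dvd_finsetProd_iff Q).mp h
      exact hdist k l (Finset.ne_of_mem_erase hl).symm
        ((hirr k).associated_of_dvd (hirr l) hkl)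
    · exact (hgen.of_dvd (hQP k)).not_dvd_pderiv (hirr k).not_isUnit h
  rw [hfac, ← Finset.mul_prod_erase _ Q (Finset.mem_univ i)] at hdP
  exact (IsRelPrime.prod_right fun k hk =>
    ((hirr k).isRelPrime_iff_not_dvd.mpr (hndvd k (Finset.ne_of_mem_erase hk))).symm)
    |>.dvd_of_dvd_mul_right hdP
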